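/- arXiv:2506.14734 — 9 statements merged into one kernel-verified Lean document; each statement's English description precedes it below -/
import Mathlib

section
/- Let S be a string of length n over a finite totally ordered alphabet Σ and let π be an order-preserving permutation for S. If i, j ∈ [n], k ≥ 1 satisfy i + k − 1 ≤ n, j + k − 1 ≤ n, S[i, i+k−1] = S[j, j+k−1] and π(i) < π(j), then π(i+t) < π(j+t) for every t ∈ {0, 1, …, k−1}. -/
/-!
Common definitions: strings are modeled as functions `S : ℕ → A` with 1-based
positions `1,…,n`; patterns/substrings as `List A`.
-/

open scoped Classical

/-- Length of the longest common prefix of the suffixes `S[i,n]` and `S[j,n]`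
(1-based indexing): the largest `k` with `i+k-1 ≤ n`, `j+k-1 ≤ n` and
`S[i,i+k-1] = S[j,j+k-1]`. -/
noncomputable def rlce {A : Type*} (S : ℕ → A) (n i j : ℕ) : ℕ :=
  Nat.findGreatest
    (fun k => i + k ≤ n + 1 ∧ j + k ≤ n + 1 ∧ ∀ t < k, S (i + t) = S (j + t)) n

/-- `π` is order-preserving for the string `S[1,n]`: whenever `π i < π j` and
`S[i,i+1] = S[j,j+1]` (for `i, j ∈ [n-1]`), also `π (i+1) < π (j+1)`. -/
def OrderPres {A : Type*} (S : ℕ → A) (n : ℕ) (π : ℕ → ℕ) : Prop :=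
  ∀ i j, 1 ≤ i → i < n → 1 ≤ j → j < n → π i < π j →
    S i = S j → S (i + 1) = S (j + 1) → π (i + 1) < π (j + 1)

/-- `π` is a permutation of `{1,…,n}`. -/
def PermOn (π : ℕ → ℕ) (n : ℕ) : Prop :=
  Set.BijOn π (Set.Icc 1 n) (Set.Icc 1 n)

/-- Generalized Longest Previous Factor array `LPF_π` of `S[1,n]`:
`LPF_π[i] = 0` if `π i = 1`, and `LPF_π[i] = max { rlce(j,i) : j ∈ [n], π j < π i }`
otherwise. -/
noncomputable def LPF {A : Type*} (S : ℕ → A) (n : ℕ) (π : ℕ → ℕ) (i : ℕ) : ℕ :=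
  if π i = 1 then 0
  else ((Finset.Icc 1 n).filter (fun j => π j < π i)).sup (fun j => rlce S n j i)

/-- `i` is an irreducible `LPF_π` position: `i = 1` or `LPF_π[i] ≠ LPF_π[i-1] - 1`
(the right-hand side taken over the integers). -/
def Irr {A : Type*} (S : ℕ → A) (n : ℕ) (π : ℕ → ℕ) (i : ℕ) : Prop :=
  i = 1 ∨ (LPF S n π i : ℤ) ≠ (LPF S n π (i - 1) : ℤ) - 1

/-- The Path Decomposition Array `PDA_π = { i + LPF_π[i] : i ∈ [n] }`, as a finite set. -/
noncomputable def PDA {A : Type*} (S : ℕ → A) (n : ℕ) (π : ℕ → ℕ) : Finset ℕ :=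
  (Finset.Icc 1 n).image (fun i => i + LPF S n π i)

/-- The string `w` occurs in `S` starting at (1-based) position `i`. -/
def occursAt {A : Type*} (S : ℕ → A) (w : List A) (i : ℕ) : Prop :=
  ∀ (t : ℕ) (ht : t < w.length), S (i + t) = w.get ⟨t, ht⟩

/-- `w` is a substring of `S[1,n]`. -/
def IsSubstr {A : Type*} (S : ℕ → A) (n : ℕ) (w : List A) : Prop :=
  ∃ i, 1 ≤ i ∧ i + w.length ≤ n + 1 ∧ occursAt S w i

/-- `w` is a suffix of the prefix `S[1,j]`. -/
def SuffixOfPrefix {A : Type*} (S : ℕ → A) (w : List A) (j : ℕ) : Prop :=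
  w.length ≤ j ∧ occursAt S w (j - w.length + 1)

/-- `w` is a right-maximal substring of `S[1,n]`: it is a substring of `S[1,n]` and
either a suffix of `S[1,n]`, or it has two distinct one-character right-extensions
occurring in `S[1,n]`. -/
def RightMaximal {A : Type*} (S : ℕ → A) (n : ℕ) (w : List A) : Prop :=
  IsSubstr S n w ∧
    (SuffixOfPrefix S w n ∨
      ∃ a b : A, a ≠ b ∧ IsSubstr S n (w ++ [a]) ∧ IsSubstr S n (w ++ [b]))

/-- `T[1,n]` is a text: `n ≥ 1` and the terminator `T n` is strictly smaller than
(in particular, different from) every other symbol of the text. -/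
def IsText {A : Type*} [LT A] (T : ℕ → A) (n : ℕ) : Prop :=
  1 ≤ n ∧ ∀ i, 1 ≤ i → i < n → T n < T i

/-- The suffix `S[i,n]` as a list. -/
def sufList {A : Type*} (S : ℕ → A) (n i : ℕ) : List A :=
  (List.range (n + 1 - i)).map (fun t => S (i + t))

/-- The prefix `S[1,i]` as a list. -/
def preList {A : Type*} (S : ℕ → A) (i : ℕ) : List A :=
  (List.range i).map (fun t => S (1 + t))

/-- `SA` is the suffix array of `T[1,n]`: a permutation of `[n]` listing the starting
positions of the suffixes of `T` in increasing lexicographic order. -/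
def IsSA {A : Type*} [LinearOrder A] (T : ℕ → A) (n : ℕ) (SA : ℕ → ℕ) : Prop :=
  PermOn SA n ∧ ∀ i j, 1 ≤ i → i < j → j ≤ n →
    List.Lex (· < ·) (sufList T n (SA i)) (sufList T n (SA j))

/-- `g` is the inverse of `f` on `{1,…,n}`. -/
def IsInv (f g : ℕ → ℕ) (n : ℕ) : Prop :=
  (∀ i, 1 ≤ i → i ≤ n → g (f i) = i) ∧ (∀ i, 1 ≤ i → i ≤ n → f (g i) = i)

/-- `PA` is the prefix array of `T[1,n]`: a permutation of `[n]` listing the ending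
positions of the prefixes of `T` in increasing colexicographic order. -/
def IsPA {A : Type*} [LinearOrder A] (T : ℕ → A) (n : ℕ) (PA : ℕ → ℕ) : Prop :=
  PermOn PA n ∧ ∀ i j, 1 ≤ i → i < j → j ≤ n →
    List.Lex (· < ·) (preList T (PA i)).reverse (preList T (PA j)).reverse

/-- The Burrows–Wheeler transform: `BWT[i] = T[SA[i] - 1]`, with the convention
`T[0] := T[n]`. -/
def BWT {A : Type*} (T : ℕ → A) (n : ℕ) (SA : ℕ → ℕ) (i : ℕ) : A :=
  T (if SA i = 1 then n else SA i - 1)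

/-- The co-Burrows–Wheeler transform: `coBWT[i] = T[PA[i] + 1]`, with the convention
`T[n+1] := T[1]`. -/
def coBWT {A : Type*} (T : ℕ → A) (n : ℕ) (PA : ℕ → ℕ) (i : ℕ) : A :=
  T (if PA i = n then 1 else PA i + 1)

/-- Number of maximal equal-symbol runs of `B[1,n]` (for `n ≥ 1`). -/
noncomputable def runs {A : Type*} (B : ℕ → A) (n : ℕ) : ℕ :=
  1 + ((Finset.Icc 2 n).filter (fun i => B i ≠ B (i - 1))).card

/-- If `π` is an order-preserving permutation for `S[1,n]`,
`S[i,i+k-1] = S[j,j+k-1]` (both within bounds, `k ≥ 1`) and `π i < π j`, then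
`π (i+t) < π (j+t)` for every `t < k`. -/
theorem orderPres_propagates {A : Type*} [Fintype A] [LinearOrder A]
    (S : ℕ → A) (n : ℕ) (π : ℕ → ℕ)
    (hperm : PermOn π n) (hop : OrderPres S n π)
    (i j k : ℕ) (hi : 1 ≤ i) (hj : 1 ≤ j) (hk : 1 ≤ k)
    (hin : i + k - 1 ≤ n) (hjn : j + k - 1 ≤ n)
    (heq : ∀ t < k, S (i + t) = S (j + t))
    (hlt : π i < π j) :
    ∀ t < k, π (i + t) < π (j + t) := by
  intro t
  induction t with
  | zero => intro _; simpa using hlt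
  | succ t ih =>
    intro ht
    exact hop (i + t) (j + t) (by omega) (by omega) (by omega) (by omega)
      (ih (by omega)) (heq t (by omega)) (heq (t + 1) ht)
end

section
/- Let S be a string of length n over a finite totally ordered alphabet Σ and let π be an order-preserving permutation for S. Then for every i ∈ {2,…,n} it holds that LPF_π[i] ≥ LPF_π[i−1] − 1; in particular, the sequence i + LPF_π[i], for i = 1,…,n, is nondecreasing. -/
/-!
Common definitions: strings are modeled as functions `S : ℕ → A` with 1-based
positions `1,…,n`; patterns/substrings as `List A`.
-/

open scoped Classical

theorem LPF_step_aux {A : Type*} (S : ℕ → A) (n : ℕ) (π : ℕ → ℕ)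
    (hperm : PermOn π n) (hop : OrderPres S n π) (i : ℕ) (hi : 1 ≤ i) (hin : i < n) :
    LPF S n π i ≤ LPF S n π (i + 1) + 1 := by
  by_cases h1 : π i = 1
  · simp [LPF, h1]
  rw [LPF, if_neg h1]
  apply Finset.sup_le
  intro j hj
  simp only [Finset.mem_filter, Finset.mem_Icc] at hj
  obtain ⟨⟨hj1, hjn⟩, hπ⟩ := hj
  by_cases hk : rlce S n j i ≤ 1
  · omega
  have hne : rlce S n j i ≠ 0 := by omega
  have hspec := Nat.findGreatest_of_ne_zero (m := rlce S n j i) (n := n)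
    (P := fun k => j + k ≤ n + 1 ∧ i + k ≤ n + 1 ∧ ∀ t < k, S (j + t) = S (i + t)) rfl hne
  obtain ⟨ha, hb, hc⟩ := hspec
  have hlt : π (j + 1) < π (i + 1) :=
    hop j i hj1 (by omega) hi hin hπ (hc 0 (by omega)) (hc 1 (by omega))
  have hmem : π (j + 1) ∈ Set.Icc 1 n := hperm.mapsTo ⟨by omega, by omega⟩
  have hpos := hmem.1
  have hle : rlce S n (j + 1) (i + 1) ≤ LPF S n π (i + 1) := by
    rw [LPF, if_neg (by omega)]
    refine Finset.le_sup (f := fun j => rlce S n j (i + 1)) ?_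
    simp only [Finset.mem_filter, Finset.mem_Icc]
    exact ⟨⟨by omega, by omega⟩, hlt⟩
  have hge : rlce S n j i - 1 ≤ rlce S n (j + 1) (i + 1) := by
    conv_rhs => rw [rlce]
    apply Nat.le_findGreatest
    · omega
    · refine ⟨by omega, by omega, fun t ht => ?_⟩
      have := hc (1 + t) (by omega)
      simpa only [← add_assoc] using this
  omega

/-- For an order-preserving permutation `π`, `LPF_π[i] ≥ LPF_π[i-1] - 1`
for every `i ∈ {2,…,n}`; in particular `i + LPF_π[i]` is nondecreasing in `i`. -/
theorem LPF_almost_nondecreasing {A : Type*} [Fintype A] [LinearOrder A]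
    (S : ℕ → A) (n : ℕ) (π : ℕ → ℕ)
    (hperm : PermOn π n) (hop : OrderPres S n π) :
    (∀ i, 2 ≤ i → i ≤ n → (LPF S n π (i - 1) : ℤ) - 1 ≤ (LPF S n π i : ℤ)) ∧
    (∀ i, 1 ≤ i → i < n → i + LPF S n π i ≤ (i + 1) + LPF S n π (i + 1)) := by
  have key := LPF_step_aux S n π hperm hop
  refine ⟨fun i h2 hn => ?_, fun i h1 hn => ?_⟩
  · have := key (i - 1) (by omega) (by omega)
    rw [Nat.sub_add_cancel (by omega : 1 ≤ i)] at this
    omega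
  · have := key i h1 hn
    omega
end

section
/- Let S be a string of length n over a finite totally ordered alphabet Σ and let π be an order-preserving permutation for S. Then the set {i + LPF_π[i] : i ∈ [n]} equals {i + LPF_π[i] : i is an irreducible LPF_π position}, and the map i ↦ i + LPF_π[i] restricted to the irreducible LPF_π positions is injective; consequently the cardinality of the set PDA_π = {i + LPF_π[i] : i ∈ [n]} equals the number of irreducible LPF_π positions. -/
/-!
Common definitions: strings are modeled as functions `S : ℕ → A` with 1-based
positions `1,…,n`; patterns/substrings as `List A`.
-/

open scoped Classical

lemma rlce_spec' {A : Type*} (S : ℕ → A) (n i j : ℕ) (hi : i ≤ n) (hj : j ≤ n) :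
    i + rlce S n i j ≤ n + 1 ∧ j + rlce S n i j ≤ n + 1 ∧
      ∀ t < rlce S n i j, S (i + t) = S (j + t) := by
  unfold rlce
  exact Nat.findGreatest_spec
    (P := fun k => i + k ≤ n + 1 ∧ j + k ≤ n + 1 ∧ ∀ t < k, S (i + t) = S (j + t))
    (m := 0) (Nat.zero_le _) ⟨by omega, by omega, by intro t ht; omega⟩

lemma LPF_step {A : Type*} (S : ℕ → A) (n : ℕ) (π : ℕ → ℕ)
    (hperm : PermOn π n) (hop : OrderPres S n π) (i : ℕ) (h1 : 1 ≤ i) (hn : i < n) :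
    LPF S n π i ≤ LPF S n π (i + 1) + 1 := by
  by_cases hp : π i = 1
  · simp [LPF, hp]
  · have e : LPF S n π i =
        ((Finset.Icc 1 n).filter (fun j => π j < π i)).sup (fun j => rlce S n j i) := by
      simp [LPF, hp]
    rw [e]
    apply Finset.sup_le
    intro j hj
    simp only [Finset.mem_filter, Finset.mem_Icc] at hj
    obtain ⟨⟨hj1, hjn⟩, hlt⟩ := hj
    obtain ⟨a, b, c⟩ := rlce_spec' S n j i hjn hn.le
    by_cases hl : rlce S n j i ≤ 1
    · omega
    have hjn' : j < n := by omega
    have hlt' := hop j i hj1 hjn' h1 hn hlt (c 0 (by omega)) (c 1 (by omega))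
    have hpos : 1 ≤ π (j + 1) := (hperm.mapsTo (Set.mem_Icc.2 ⟨by omega, hjn'⟩)).1
    have hne : π (i + 1) ≠ 1 := by omega
    have e2 : rlce S n (j + 1) (i + 1) ≤ LPF S n π (i + 1) := by
      unfold LPF
      rw [if_neg hne]
      apply Finset.le_sup (f := fun j => rlce S n j (i + 1))
      simp only [Finset.mem_filter, Finset.mem_Icc]
      exact ⟨⟨by omega, hjn'⟩, hlt'⟩
    have e3 : rlce S n j i - 1 ≤ rlce S n (j + 1) (i + 1) := by
      conv_rhs => unfold rlce
      apply Nat.le_findGreatest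
      · omega
      · refine ⟨by omega, by omega, ?_⟩
        intro t ht
        have := c (t + 1) (by omega)
        rw [show j + 1 + t = j + (t + 1) by omega, show i + 1 + t = i + (t + 1) by omega]
        exact this
    omega

/-- `{i + LPF_π[i] : i ∈ [n]}` equals
`{i + LPF_π[i] : i irreducible}`, the map `i ↦ i + LPF_π[i]` is injective on the
irreducible positions, and hence `|PDA_π|` equals the number of irreducible positions. -/
theorem PDA_eq_irreducible {A : Type*} [Fintype A] [LinearOrder A]
    (S : ℕ → A) (n : ℕ) (π : ℕ → ℕ)
    (hperm : PermOn π n) (hop : OrderPres S n π) :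
    PDA S n π =
      ((Finset.Icc 1 n).filter (fun i => Irr S n π i)).image (fun i => i + LPF S n π i) ∧
    Set.InjOn (fun i => i + LPF S n π i) {i | 1 ≤ i ∧ i ≤ n ∧ Irr S n π i} ∧
    (PDA S n π).card = ((Finset.Icc 1 n).filter (fun i => Irr S n π i)).card := by
  have step := LPF_step S n π hperm hop
  have mono : ∀ a b, 1 ≤ a → a ≤ b → b ≤ n → a + LPF S n π a ≤ b + LPF S n π b := by
    intro a b ha hab
    induction b, hab using Nat.le_induction with
    | base => intro _; exact le_rfl
    | succ b hab ih =>
      intro hb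
      have := step b (by omega) (by omega)
      have := ih (by omega)
      omega
  have strict : ∀ a b, 1 ≤ a → a < b → b ≤ n → Irr S n π b →
      a + LPF S n π a < b + LPF S n π b := by
    intro a b ha hab hb hirr
    obtain ⟨c, rfl⟩ : ∃ c, b = c + 1 := ⟨b - 1, by omega⟩
    have h2 := mono a c ha (by omega) (by omega)
    have h3 := step c (by omega) (by omega)
    rcases hirr with h | h
    · omega
    · simp only [Nat.add_sub_cancel] at h
      omega
  have inj : Set.InjOn (fun i => i + LPF S n π i) {i | 1 ≤ i ∧ i ≤ n ∧ Irr S n π i} := by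
    rintro a ⟨ha1, ha2, ha3⟩ b ⟨hb1, hb2, hb3⟩ hab
    simp only at hab
    rcases lt_trichotomy a b with h | h | h
    · have := strict a b ha1 h hb2 hb3
      omega
    · exact h
    · have := strict b a hb1 h ha2 ha3
      omega
  have ex : ∀ i, 1 ≤ i → i ≤ n → ∃ k, (1 ≤ k ∧ k ≤ n) ∧ Irr S n π k ∧
      k + LPF S n π k = i + LPF S n π i := by
    intro i hi
    induction i, hi using Nat.le_induction with
    | base => intro h; exact ⟨1, ⟨le_rfl, h⟩, Or.inl rfl, rfl⟩
    | succ b hb ih =>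
      intro h
      by_cases hirr : Irr S n π (b + 1)
      · exact ⟨b + 1, ⟨by omega, h⟩, hirr, rfl⟩
      · obtain ⟨k, hk, hk2, hk3⟩ := ih (by omega)
        refine ⟨k, hk, hk2, ?_⟩
        simp only [Irr, not_or, not_not, Nat.add_sub_cancel] at hirr
        have := hirr.2
        omega
  have eq : PDA S n π =
      ((Finset.Icc 1 n).filter (fun i => Irr S n π i)).image (fun i => i + LPF S n π i) := by
    unfold PDA
    ext x
    simp only [Finset.mem_image, Finset.mem_filter, Finset.mem_Icc]
    constructor
    · rintro ⟨i, ⟨h1, h2⟩, rfl⟩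
      obtain ⟨k, hk, hk2, hk3⟩ := ex i h1 h2
      exact ⟨k, ⟨hk, hk2⟩, hk3⟩
    · rintro ⟨i, ⟨h, _⟩, rfl⟩
      exact ⟨i, h, rfl⟩
  refine ⟨eq, inj, ?_⟩
  rw [eq]
  apply Finset.card_image_of_injOn
  apply inj.mono
  intro i hi
  simp only [Finset.coe_filter, Finset.mem_Icc, Set.mem_setOf_eq] at hi
  exact ⟨hi.1.1, hi.1.2, hi.2⟩
end

section
/- Let S be a string of length n over a finite totally ordered alphabet Σ and let π be an order-preserving permutation for S. Let α be a right-maximal substring of S and let a ≠ b be two symbols such that both α·a and α·b are substrings of S. If π(α·a) < π(α·b), then there exists t ∈ PDA_π such that α·b is a suffix of S[1,t]. -/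
/-!
Common definitions: strings are modeled as functions `S : ℕ → A` with 1-based
positions `1,…,n`; patterns/substrings as `List A`.
-/

open scoped Classical

/-- `π(w) = min { π s : w occurs in S[1,n] starting at position s }`. -/
noncomputable def piMin {A : Type*} (S : ℕ → A) (n : ℕ) (π : ℕ → ℕ) (w : List A) : ℕ :=
  sInf {v | ∃ s, 1 ≤ s ∧ s + w.length ≤ n + 1 ∧ occursAt S w s ∧ v = π s}

theorem rlce_spec_aux {A : Type*} (S : ℕ → A) (n k i : ℕ) (h : rlce S n k i ≠ 0) :
    k + rlce S n k i ≤ n + 1 ∧ i + rlce S n k i ≤ n + 1 ∧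
      ∀ t < rlce S n k i, S (k + t) = S (i + t) :=
  Nat.findGreatest_of_ne_zero (P := fun m => k + m ≤ n + 1 ∧ i + m ≤ n + 1 ∧
        ∀ t < m, S (k + t) = S (i + t)) (n := n) (m := rlce S n k i) rfl h

theorem le_rlce_aux {A : Type*} (S : ℕ → A) (n k i m : ℕ) (hm : m ≤ n)
    (h : k + m ≤ n + 1 ∧ i + m ≤ n + 1 ∧ ∀ t < m, S (k + t) = S (i + t)) :
    m ≤ rlce S n k i :=
  Nat.le_findGreatest hm h

/-- Let `α` be right-maximal in `S[1,n]` and `a ≠ b` with `α·a`, `α·b`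
substrings of `S[1,n]`. If `π(α·a) < π(α·b)`, then some `t ∈ PDA_π` satisfies that
`α·b` is a suffix of `S[1,t]`. -/
theorem PDA_samples {A : Type*} [Fintype A] [LinearOrder A]
    (S : ℕ → A) (n : ℕ) (π : ℕ → ℕ)
    (hperm : PermOn π n) (hop : OrderPres S n π)
    (α : List A) (hrm : RightMaximal S n α)
    (a b : A) (hab : a ≠ b)
    (ha : IsSubstr S n (α ++ [a])) (hb : IsSubstr S n (α ++ [b]))
    (hlt : piMin S n π (α ++ [a]) < piMin S n π (α ++ [b])) :
    ∃ t ∈ PDA S n π, SuffixOfPrefix S (α ++ [b]) t := by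
  have key : ∀ w : List A, IsSubstr S n w →
      ∃ s, 1 ≤ s ∧ s + w.length ≤ n + 1 ∧ occursAt S w s ∧ piMin S n π w = π s := by
    rintro w ⟨i, h1, h2, h3⟩
    exact Nat.sInf_mem (s := {v | ∃ s, 1 ≤ s ∧ s + w.length ≤ n + 1 ∧ occursAt S w s ∧ v = π s})
      ⟨π i, i, h1, h2, h3, rfl⟩
  obtain ⟨j, j1, j2, j3, j4⟩ := key _ ha
  obtain ⟨i, i1, i2, i3, i4⟩ := key _ hb
  have hmin : ∀ s, 1 ≤ s → s + (α ++ [b]).length ≤ n + 1 → occursAt S (α ++ [b]) s →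
      π i ≤ π s := by
    intro s h1 h2 h3
    rw [← i4]
    exact Nat.sInf_le ⟨s, h1, h2, h3, rfl⟩
  rw [j4, i4] at hlt
  simp only [List.length_append, List.length_singleton] at j2 i2 hmin
  have hj1 : 1 ≤ π j := (hperm.mapsTo (Set.mem_Icc.2 ⟨j1, by omega⟩)).1
  have hL : LPF S n π i = α.length := by
    unfold LPF
    rw [if_neg (by omega)]
    apply le_antisymm
    · apply Finset.sup_le
      intro k hk
      simp only [Finset.mem_filter, Finset.mem_Icc] at hk
      by_contra hcon
      push Not at hcon
      have hspec := rlce_spec_aux S n k i (by omega)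
      obtain ⟨q1, q2, q3⟩ := hspec
      have := hmin k hk.1.1 (by omega) (fun t ht => by
        rw [← i3 t ht]
        apply q3
        simp only [List.length_append, List.length_singleton] at ht
        omega)
      omega
    · refine le_trans ?_ (Finset.le_sup (f := fun k => rlce S n k i) (b := j) ?_)
      · refine le_rlce_aux S n j i _ (by omega) ⟨by omega, by omega, ?_⟩
        intro t ht
        rw [j3 t (by simp; omega), i3 t (by simp; omega)]
        simp [List.getElem_append_left ht]
      · simp only [Finset.mem_filter, Finset.mem_Icc]
        exact ⟨⟨j1, by omega⟩, hlt⟩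
  refine ⟨i + α.length, ?_, ?_⟩
  · refine Finset.mem_image.2 ⟨i, Finset.mem_Icc.2 ⟨i1, by omega⟩, by simp only [hL]⟩
  · refine ⟨by simp; omega, ?_⟩
    have : i + α.length - (α ++ [b]).length + 1 = i := by simp; omega
    rw [this]
    exact i3
end

section
/- Let S be a string of length n over a finite totally ordered alphabet Σ and let π be an order-preserving permutation for S. For every irreducible LPF_π position i with LPF_π[i] > 0 there exists a source s_i ∈ [n] with π(s_i) < π(i) and S[s_i, s_i + LPF_π[i] − 1] = S[i, i + LPF_π[i] − 1]; fix one such choice s_i for each such i. Then any string S' ∈ Σ^n satisfying, for every irreducible LPF_π position i, both (a) S'[i + LPF_π[i]] = S[i + LPF_π[i]] whenever i + LPF_π[i] ≤ n, and (b) S'[s_i + t] = S'[i + t] for every t ∈ {0,…,LPF_π[i] − 1} whenever LPF_π[i] > 0, must be equal to S. (This is the decodability claim underlying the theorem that S can be compressed into O(|PDA_π| log n) bits.) -/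
/-!
Common definitions: strings are modeled as functions `S : ℕ → A` with 1-based
positions `1,…,n`; patterns/substrings as `List A`.
-/

open scoped Classical

theorem LPF_source {A : Type*} (S : ℕ → A) (n : ℕ) (π : ℕ → ℕ) (i : ℕ)
    (h : 0 < LPF S n π i) :
    i + LPF S n π i ≤ n + 1 ∧ ∃ s, 1 ≤ s ∧ s ≤ n ∧ s + LPF S n π i ≤ n + 1 ∧ π s < π i ∧
        ∀ t < LPF S n π i, S (s + t) = S (i + t) := by
  have h1 : π i ≠ 1 := by
    intro h1
    simp [LPF, h1] at h
  have e : LPF S n π i =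
      ((Finset.Icc 1 n).filter (fun j => π j < π i)).sup (fun j => rlce S n j i) := by
    simp [LPF, h1]
  have hne : ((Finset.Icc 1 n).filter (fun j => π j < π i)).Nonempty := by
    rw [Finset.nonempty_iff_ne_empty]
    intro h2
    rw [e, h2] at h
    simp at h
  obtain ⟨s, hs, hs2⟩ := Finset.exists_mem_eq_sup _ hne (fun j => rlce S n j i)
  have e2 : rlce S n s i = LPF S n π i := by rw [e, hs2]
  rw [Finset.mem_filter, Finset.mem_Icc] at hs
  have := Nat.findGreatest_of_ne_zero (e2 : Nat.findGreatest _ n = LPF S n π i) (by omega)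
  exact ⟨this.2.1, s, hs.1.1, hs.1.2, this.1, hs.2, this.2.2⟩

theorem exists_irr {A : Type*} (S : ℕ → A) (n : ℕ) (π : ℕ → ℕ) (j : ℕ) (hj : 1 ≤ j) :
    ∃ i, 1 ≤ i ∧ i ≤ j ∧ Irr S n π i ∧ i + LPF S n π i = j + LPF S n π j := by
  induction j, hj using Nat.le_induction with
  | base => exact ⟨1, le_rfl, le_rfl, Or.inl rfl, rfl⟩
  | succ j hj ih =>
    by_cases h : Irr S n π (j + 1)
    · exact ⟨j + 1, by omega, le_rfl, h, rfl⟩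
    · obtain ⟨i, h1, h2, h3, h4⟩ := ih
      refine ⟨i, h1, by omega, h3, ?_⟩
      simp only [Irr, not_or, not_not, Nat.add_sub_cancel] at h
      have := h.2
      omega

/-- Sources exist for every irreducible position with positive `LPF_π`,
and any string `S'` that agrees with the stored characters `S[i + LPF_π[i]]` and is
self-consistent along the chosen sources must equal `S` on `[1,n]` (decodability). -/
theorem compressed_representation_decodable {A : Type*} [Fintype A] [LinearOrder A]
    (S : ℕ → A) (n : ℕ) (π : ℕ → ℕ)
    (hperm : PermOn π n) (hop : OrderPres S n π) :
    (∀ i, 1 ≤ i → i ≤ n → Irr S n π i → 0 < LPF S n π i →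
      ∃ s, 1 ≤ s ∧ s ≤ n ∧ s + LPF S n π i ≤ n + 1 ∧ π s < π i ∧
        ∀ t < LPF S n π i, S (s + t) = S (i + t)) ∧
    (∀ src : ℕ → ℕ,
      (∀ i, 1 ≤ i → i ≤ n → Irr S n π i → 0 < LPF S n π i →
        1 ≤ src i ∧ src i ≤ n ∧ src i + LPF S n π i ≤ n + 1 ∧ π (src i) < π i ∧
          ∀ t < LPF S n π i, S (src i + t) = S (i + t)) →
      ∀ S' : ℕ → A,
        (∀ i, 1 ≤ i → i ≤ n → Irr S n π i → i + LPF S n π i ≤ n →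
          S' (i + LPF S n π i) = S (i + LPF S n π i)) →
        (∀ i, 1 ≤ i → i ≤ n → Irr S n π i → 0 < LPF S n π i →
          ∀ t < LPF S n π i, S' (src i + t) = S' (i + t)) →
        ∀ j, 1 ≤ j → j ≤ n → S' j = S j) := by
  refine ⟨fun i _ _ _ h => (LPF_source S n π i h).2, ?_⟩
  intro src hsrc S' ha hb
  have key : ∀ m j, π j = m → 1 ≤ j → j ≤ n → S' j = S j := by
    intro m
    induction m using Nat.strong_induction_on with
    | _ m ih =>
    intro j hm hj hjn
    obtain ⟨i, h1, h2, h3, h4⟩ := exists_irr S n π j hj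
    rcases Nat.eq_zero_or_pos (LPF S n π j) with h0 | h0
    · have := ha i h1 (by omega) h3 (by omega)
      have e : i + LPF S n π i = j := by omega
      rwa [e] at this
    · have hL : 0 < LPF S n π i := by omega
      obtain ⟨s1, s2, s3, s4, s5⟩ := hsrc i h1 (by omega) h3 hL
      have hb' := hb i h1 (by omega) h3 hL (j - i) (by omega)
      have hn := (LPF_source S n π i hL).1
      have hlt : ∀ t, t < LPF S n π i → π (src i + t) < π (i + t) := by
        intro t
        induction t with
        | zero => intro _; exact s4
        | succ t iht =>
          intro ht
          exact hop (src i + t) (i + t) (by omega) (by omega) (by omega) (by omega)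
            (iht (by omega)) (s5 t (by omega)) (s5 (t + 1) ht)
      have hl := hlt (j - i) (by omega)
      have s5' := s5 (j - i) (by omega)
      have e : i + (j - i) = j := by omega
      rw [e] at hl hb' s5'
      rw [← hb', ← s5']
      exact ih _ (by omega) _ rfl (by omega) (by omega)
  exact fun j => key _ j rfl
end

section
/- Let T be a text of length n over a finite totally ordered alphabet Σ and let α be a right-maximal substring of T such that at least two distinct symbols c satisfy that α·c is a substring of T. Then {c ∈ Σ : α·c is a substring of T} = {T[j+1] : j ∈ st-lex, 0 ≤ j ≤ n−1, and α is a suffix of T[1,j]}. -/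
/-!
Common definitions: strings are modeled as functions `S : ℕ → A` with 1-based
positions `1,…,n`; patterns/substrings as `List A`.
-/

open scoped Classical

/-- The set `st-lex = { j - 1 : j ∈ st-lex⁻ ∪ st-lex⁺ ∪ {n+1} }`. -/
noncomputable def stlexSet {A : Type*} (T : ℕ → A) (n : ℕ) (ISA : ℕ → ℕ) : Finset ℕ :=
  ((PDA T n ISA ∪ PDA T n (fun i => n - ISA i + 1)) ∪ {n + 1}).image (fun j => j - 1)

theorem aux_occ {A : Type*} (S : ℕ → A) (α : List A) (c : A) (i : ℕ) :
    occursAt S (α ++ [c]) i ↔ occursAt S α i ∧ S (i + α.length) = c := by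
  constructor
  · intro h
    refine ⟨fun t ht => ?_, ?_⟩
    · have := h t (by simp; omega)
      simpa [List.getElem_append, ht] using this
    · have := h α.length (by simp)
      simpa using this
  · rintro ⟨h, hc⟩ t ht
    simp at ht
    rcases Nat.lt_or_ge t α.length with h1 | h1
    · have := h t h1
      simpa [List.getElem_append, h1] using this
    · obtain rfl : t = α.length := by omega
      simpa using hc

theorem aux_prefix {A : Type*} (S : ℕ → A) (n : ℕ) (w : List A) (i : ℕ)
    (hi : i + w.length ≤ n + 1) (h : occursAt S w i) : w <+: sufList S n i := by
  rw [List.prefix_iff_getElem]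
  refine ⟨by simp [sufList]; omega, fun t ht => ?_⟩
  have := h t ht
  simp [sufList, this]

theorem aux_lex {A : Type*} [LinearOrder A] (α x y : List A) (b c : A) (hbc : b < c) :
    ¬ List.Lex (· < ·) (α ++ c :: x) (α ++ b :: y) := by
  induction α with
  | nil =>
    intro h
    cases h with
    | cons h => exact lt_irrefl _ hbc
    | rel h => exact lt_asymm h hbc
  | cons a l ih =>
    intro h
    cases h with
    | cons h => exact ih h
    | rel h => exact lt_irrefl _ h

theorem aux_isa {A : Type*} [LinearOrder A] (T : ℕ → A) (n : ℕ) (SA ISA : ℕ → ℕ)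
    (hSA : IsSA T n SA) (hISA : IsInv SA ISA n) (p : ℕ) (h1 : 1 ≤ p) (h2 : p ≤ n) :
    1 ≤ ISA p ∧ ISA p ≤ n ∧ SA (ISA p) = p := by
  obtain ⟨q, hq, rfl⟩ := hSA.1.surjOn (show p ∈ Set.Icc 1 n from ⟨h1, h2⟩)
  have := hISA.1 q hq.1 hq.2
  rw [this]
  exact ⟨hq.1, hq.2, rfl⟩

theorem aux_lt {A : Type*} [LinearOrder A] (T : ℕ → A) (n : ℕ) (SA ISA : ℕ → ℕ)
    (hSA : IsSA T n SA) (hISA : IsInv SA ISA n) (α : List A) (b c : A) (hbc : b < c)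
    (k i : ℕ) (hk1 : 1 ≤ k) (hk : k + α.length ≤ n) (hko : occursAt T (α ++ [b]) k)
    (hi1 : 1 ≤ i) (hi : i + α.length ≤ n) (hio : occursAt T (α ++ [c]) i) :
    ISA k < ISA i := by
  obtain ⟨a1, a2, a3⟩ := aux_isa T n SA ISA hSA hISA k hk1 (by omega)
  obtain ⟨b1, b2, b3⟩ := aux_isa T n SA ISA hSA hISA i hi1 (by omega)
  obtain ⟨x, hx⟩ := aux_prefix T n _ k (by simp; omega) hko
  obtain ⟨y, hy⟩ := aux_prefix T n _ i (by simp; omega) hio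
  rcases lt_trichotomy (ISA k) (ISA i) with h | h | h
  · exact h
  · exfalso
    have hki : k = i := by rw [← a3, ← b3, h]
    subst hki
    have e1 := ((aux_occ _ _ _ _).1 hko).2
    have e2 := ((aux_occ _ _ _ _).1 hio).2
    exact hbc.ne (e1.symm.trans e2)
  · exfalso
    have := hSA.2 _ _ b1 h a2
    rw [a3, b3, ← hx, ← hy] at this
    simp only [List.append_assoc, List.singleton_append] at this
    exact aux_lex _ _ _ _ _ hbc this

theorem aux_pda {A : Type*} (T : ℕ → A) (n : ℕ) (π : ℕ → ℕ) (α : List A) (c : A)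
    (k : ℕ) (hk1 : 1 ≤ k) (hk : k + α.length ≤ n) (hko : occursAt T α k) (hpk : 1 ≤ π k)
    (hlt : ∀ i, 1 ≤ i → i + α.length ≤ n → occursAt T (α ++ [c]) i → π k < π i)
    (hc : IsSubstr T n (α ++ [c])) :
    ∃ i, 1 ≤ i ∧ i + α.length ≤ n ∧ occursAt T (α ++ [c]) i ∧ i + α.length ∈ PDA T n π := by
  have hne : ∃ v i, 1 ≤ i ∧ i + α.length ≤ n ∧ occursAt T (α ++ [c]) i ∧ π i = v := by
    obtain ⟨i, h1, h2, h3⟩ := hc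
    simp at h2
    exact ⟨π i, i, h1, by omega, h3, rfl⟩
  obtain ⟨i, h1, h2, h3, h4⟩ := Nat.find_spec hne
  have hmin := fun v => @Nat.find_min _ _ hne v
  rw [← h4] at hmin
  refine ⟨i, h1, h2, h3, ?_⟩
  have hki := hlt i h1 h2 h3
  have h3' := (aux_occ _ _ _ _).1 h3
  have hL : LPF T n π i = α.length := by
    unfold LPF
    rw [if_neg (by omega)]
    apply le_antisymm
    · apply Finset.sup_le
      intro j hj
      simp only [Finset.mem_filter, Finset.mem_Icc] at hj
      by_contra hcon
      have hpos : rlce T n j i ≠ 0 := by omega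
      obtain ⟨r1, r2, r3⟩ := Nat.findGreatest_of_ne_zero (P := fun k => j + k ≤ n + 1 ∧ i + k ≤ n + 1 ∧ ∀ t < k, T (j + t) = T (i + t)) (n := n) (m := rlce T n j i) rfl hpos
      refine hmin (π j) hj.2 ⟨j, hj.1.1, by omega, ?_, rfl⟩
      intro t ht
      rw [r3 t (by simp at ht; omega)]
      exact h3 t ht
    · have hle : α.length ≤ rlce T n k i := by
        apply Nat.le_findGreatest (by omega)
        refine ⟨by omega, by omega, fun t ht => ?_⟩
        rw [hko t ht, h3'.1 t ht]
      refine hle.trans (Finset.le_sup (f := fun j => rlce T n j i) ?_)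
      simp only [Finset.mem_filter, Finset.mem_Icc]
      exact ⟨⟨hk1, by omega⟩, hki⟩
  unfold PDA
  rw [Finset.mem_image]
  exact ⟨i, Finset.mem_Icc.2 ⟨h1, by omega⟩, by rw [hL]⟩

/-- For a right-maximal substring `α` of the text `T[1,n]` with at least
two distinct one-character right-extensions, the set of symbols `c` with `α·c` a substring
of `T` equals the set of symbols `T[j+1]` over `j ∈ st-lex`, `0 ≤ j ≤ n-1`, with `α` a
suffix of `T[1,j]`. -/
theorem outgoing_labels_eq_stlex_labels {A : Type*} [Fintype A] [LinearOrder A]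
    (T : ℕ → A) (n : ℕ) (htext : IsText T n)
    (SA ISA : ℕ → ℕ) (hSA : IsSA T n SA) (hISA : IsInv SA ISA n)
    (α : List A) (hrm : RightMaximal T n α)
    (h2 : ∃ a b : A, a ≠ b ∧ IsSubstr T n (α ++ [a]) ∧ IsSubstr T n (α ++ [b])) :
    {c : A | IsSubstr T n (α ++ [c])} =
      {c : A | ∃ j ∈ stlexSet T n ISA, j + 1 ≤ n ∧ SuffixOfPrefix T α j ∧ c = T (j + 1)} := by
  ext c
  simp only [Set.mem_setOf_eq]
  constructor
  · intro hc
    have hb : ∃ b, b ≠ c ∧ IsSubstr T n (α ++ [b]) := by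
      obtain ⟨a, b, hab, ha, hb⟩ := h2
      by_cases h : a = c
      · exact ⟨b, fun h' => hab (h.trans h'.symm), hb⟩
      · exact ⟨a, h, ha⟩
    obtain ⟨b, hbc, k, hk1, hk, hko⟩ := hb
    simp at hk
    have hk' : k + α.length ≤ n := by omega
    obtain ⟨a1, a2, a3⟩ := aux_isa T n SA ISA hSA hISA k hk1 (by omega)
    have hko' := ((aux_occ _ _ _ _).1 hko).1
    have key : ∃ i, 1 ≤ i ∧ i + α.length ≤ n ∧ occursAt T (α ++ [c]) i ∧
        i + α.length ∈ PDA T n ISA ∪ PDA T n (fun i => n - ISA i + 1) := by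
      rcases lt_or_gt_of_ne hbc with h | h
      · obtain ⟨i, i1, i2, i3, i4⟩ := aux_pda T n ISA α c k hk1 hk' hko' a1
          (fun i h1 h2 h3 => aux_lt T n SA ISA hSA hISA α b c h k i hk1 hk' hko h1 h2 h3) hc
        exact ⟨i, i1, i2, i3, Finset.mem_union_left _ i4⟩
      · obtain ⟨i, i1, i2, i3, i4⟩ := aux_pda T n (fun i => n - ISA i + 1) α c k hk1 hk' hko'
          (by simp)
          (fun i h1 h2 h3 => by
            have := aux_lt T n SA ISA hSA hISA α c b h i k h1 h2 h3 hk1 hk' hko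
            omega) hc
        exact ⟨i, i1, i2, i3, Finset.mem_union_right _ i4⟩
    obtain ⟨i, i1, i2, i3, i4⟩ := key
    have i3' := (aux_occ _ _ _ _).1 i3
    refine ⟨i + α.length - 1, ?_, by omega, ⟨by omega, ?_⟩, ?_⟩
    · unfold stlexSet
      exact Finset.mem_image.2 ⟨_, Finset.mem_union_left _ i4, rfl⟩
    · rw [show i + α.length - 1 - α.length + 1 = i by omega]
      exact i3'.1
    · rw [show i + α.length - 1 + 1 = i + α.length by omega]
      exact i3'.2.symm
  · rintro ⟨j, -, hj, ⟨hl, ho⟩, rfl⟩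
    refine ⟨j - α.length + 1, by omega, by simp; omega, (aux_occ _ _ _ _).2 ⟨ho, ?_⟩⟩
    rw [show j - α.length + 1 + α.length = j + 1 by omega]
end

section
/- Let T be a text of length n over a finite totally ordered alphabet Σ, let α be a right-maximal substring of T, and let C = {c ∈ Σ : α·c is a substring of T}. (a) For every c ∈ C with c ≠ min C: if s is the starting position of the lexicographically smallest suffix of T having α·c as a prefix, then s + |α| ∈ st-lex^-. (b) For every c ∈ C with c ≠ max C: if s is the starting position of the lexicographically largest suffix of T having α·c as a prefix, then s + |α| ∈ st-lex^+. -/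
/-!
Common definitions: strings are modeled as functions `S : ℕ → A` with 1-based
positions `1,…,n`; patterns/substrings as `List A`.
-/

open scoped Classical

theorem my_suf_cons {A : Type*} (T : ℕ → A) (n i : ℕ) (h : i ≤ n) :
    sufList T n i = T i :: sufList T n (i + 1) := by
  unfold sufList
  have : n + 1 - i = (n + 1 - (i + 1)) + 1 := by omega
  rw [this, List.range_succ_eq_map]
  simp only [List.map_cons, List.map_map, Nat.add_zero]
  congr 1
  apply List.map_congr_left
  intro t _
  simp only [Function.comp]
  congr 1
  omega

theorem my_lex_of_mismatch {A : Type*} [LinearOrder A] (T : ℕ → A) (n m : ℕ) :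
    ∀ i j, i + m ≤ n → j + m ≤ n → (∀ t < m, T (i + t) = T (j + t)) →
      T (i + m) < T (j + m) → List.Lex (· < ·) (sufList T n i) (sufList T n j) := by
  induction m with
  | zero =>
    intro i j hi hj _ hlt
    rw [my_suf_cons T n i hi, my_suf_cons T n j hj]
    exact List.Lex.rel hlt
  | succ m ih =>
    intro i j hi hj he hlt
    rw [my_suf_cons T n i (by omega), my_suf_cons T n j (by omega)]
    have h0 := he 0 (by omega)
    simp only [Nat.add_zero] at h0
    rw [h0]
    apply List.Lex.cons
    apply ih (i + 1) (j + 1) (by omega) (by omega)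
    · intro t ht
      have := he (t + 1) (by omega)
      rwa [show i + 1 + t = i + (t + 1) by omega, show j + 1 + t = j + (t + 1) by omega]
    · rwa [show i + 1 + m = i + (m + 1) by omega, show j + 1 + m = j + (m + 1) by omega]

theorem my_asymm {A : Type*} [LinearOrder A] (a b : List A)
    (h : List.Lex (· < ·) a b) (h' : List.Lex (· < ·) b a) : False := by
  have h1 : a < b := h
  have h2 : b < a := h'
  exact lt_asymm h1 h2

theorem my_isa_range {A : Type*} [LinearOrder A] (T : ℕ → A) (n : ℕ)
    (SA ISA : ℕ → ℕ) (hSA : IsSA T n SA) (hISA : IsInv SA ISA n) (i : ℕ)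
    (h1 : 1 ≤ i) (h2 : i ≤ n) : 1 ≤ ISA i ∧ ISA i ≤ n := by
  obtain ⟨k, hk, rfl⟩ := hSA.1.surjOn (show i ∈ Set.Icc 1 n from ⟨h1, h2⟩)
  rw [hISA.1 k hk.1 hk.2]
  exact hk

theorem my_isa_lt {A : Type*} [LinearOrder A] (T : ℕ → A) (n : ℕ)
    (SA ISA : ℕ → ℕ) (hSA : IsSA T n SA) (hISA : IsInv SA ISA n) (i j : ℕ)
    (hi1 : 1 ≤ i) (hi2 : i ≤ n) (hj1 : 1 ≤ j) (hj2 : j ≤ n)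
    (h : List.Lex (· < ·) (sufList T n i) (sufList T n j)) : ISA i < ISA j := by
  have ri := my_isa_range T n SA ISA hSA hISA i hi1 hi2
  have rj := my_isa_range T n SA ISA hSA hISA j hj1 hj2
  have ei := hISA.2 i hi1 hi2
  have ej := hISA.2 j hj1 hj2
  rcases lt_trichotomy (ISA i) (ISA j) with h' | h' | h'
  · exact h'
  · rw [h', ej] at ei
    subst ei
    exact (my_asymm _ _ h h).elim
  · have := hSA.2 _ _ rj.1 h' ri.2
    rw [ei, ej] at this
    exact (my_asymm _ _ h this).elim

theorem my_occ {A : Type*} (T : ℕ → A) (α : List A) (c : A) (i : ℕ) :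
    occursAt T (α ++ [c]) i ↔
      (∀ (t : ℕ) (ht : t < α.length), T (i + t) = α[t]) ∧ T (i + α.length) = c := by
  unfold occursAt
  constructor
  · intro h
    constructor
    · intro t ht
      have := h t (by simp; omega)
      simpa [List.getElem_append_left ht] using this
    · have := h α.length (by simp)
      simpa using this
  · rintro ⟨h1, h2⟩ t ht
    simp only [List.length_append, List.length_singleton] at ht
    rcases Nat.lt_succ_iff_lt_or_eq.mp ht with h | h
    · simp [List.getElem_append_left h, h1 t h]
    · subst h
      simp [h2]

theorem my_main {A : Type*} (T : ℕ → A) (n : ℕ) (π : ℕ → ℕ) (α : List A) (c c' : A)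
    (hc : c' ≠ c) (s j : ℕ) (hs : 1 ≤ s) (hsn : s + (α.length + 1) ≤ n + 1)
    (hso : occursAt T (α ++ [c]) s) (hj : 1 ≤ j) (hjn : j + (α.length + 1) ≤ n + 1)
    (hjo : occursAt T (α ++ [c']) j) (hpos : 1 ≤ π j) (hlt : π j < π s)
    (hmin : ∀ s', 1 ≤ s' → s' + (α.length + 1) ≤ n + 1 → occursAt T (α ++ [c]) s' → s' ≠ s →
      π s < π s') : s + α.length ∈ PDA T n π := by
  rw [my_occ] at hso hjo
  unfold PDA
  rw [Finset.mem_image]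
  refine ⟨s, Finset.mem_Icc.mpr ⟨hs, by omega⟩, ?_⟩
  congr 1
  unfold LPF
  rw [if_neg (by omega)]
  apply le_antisymm
  · apply Finset.sup_le
    intro i hi
    rw [Finset.mem_filter, Finset.mem_Icc] at hi
    by_contra hcon
    push Not at hcon
    have hspec := Nat.findGreatest_spec (P := fun k => i + k ≤ n + 1 ∧ s + k ≤ n + 1 ∧
      ∀ t < k, T (i + t) = T (s + t)) (n := n) (Nat.zero_le n)
      ⟨by omega, by omega, fun t ht => absurd ht (Nat.not_lt_zero t)⟩
    change i + rlce T n i s ≤ n + 1 ∧ s + rlce T n i s ≤ n + 1 ∧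
      ∀ t < rlce T n i s, T (i + t) = T (s + t) at hspec
    obtain ⟨h1, h2, h3⟩ := hspec
    have hne : i ≠ s := by
      rintro rfl
      omega
    have := hmin i hi.1.1 (by omega) ((my_occ T α c i).mpr
      ⟨fun t ht => (h3 t (by omega)).trans (hso.1 t ht),
        (h3 _ hcon).trans hso.2⟩) hne
    omega
  · have hle : α.length ≤ rlce T n j s := by
      apply Nat.le_findGreatest (by omega)
      exact ⟨by omega, by omega, fun t ht => (hjo.1 t ht).trans (hso.1 t ht).symm⟩
    refine hle.trans (Finset.le_sup (f := fun j => rlce T n j s) ?_)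
    rw [Finset.mem_filter, Finset.mem_Icc]
    exact ⟨⟨hj, by omega⟩, hlt⟩

/-- Let `α` be right-maximal in the text `T[1,n]` and
`C = {c : α·c occurs in T}`.
(a) If `c ∈ C` is not the minimum of `C` and `s` starts the lexicographically smallest
suffix of `T` having `α·c` as a prefix, then `s + |α| ∈ st-lex⁻`.
(b) If `c ∈ C` is not the maximum of `C` and `s` starts the lexicographically largest
suffix of `T` having `α·c` as a prefix, then `s + |α| ∈ st-lex⁺`. -/
theorem extremal_suffix_sampled {A : Type*} [Fintype A] [LinearOrder A]
    (T : ℕ → A) (n : ℕ) (htext : IsText T n)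
    (SA ISA : ℕ → ℕ) (hSA : IsSA T n SA) (hISA : IsInv SA ISA n)
    (α : List A) (hrm : RightMaximal T n α) :
    (∀ c : A, IsSubstr T n (α ++ [c]) →
      (∃ c', c' < c ∧ IsSubstr T n (α ++ [c'])) →
      ∀ s, 1 ≤ s → s + (α.length + 1) ≤ n + 1 → occursAt T (α ++ [c]) s →
        (∀ s', 1 ≤ s' → s' + (α.length + 1) ≤ n + 1 → occursAt T (α ++ [c]) s' → s' ≠ s →
          List.Lex (· < ·) (sufList T n s) (sufList T n s')) →
        s + α.length ∈ PDA T n ISA) ∧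
    (∀ c : A, IsSubstr T n (α ++ [c]) →
      (∃ c', c < c' ∧ IsSubstr T n (α ++ [c'])) →
      ∀ s, 1 ≤ s → s + (α.length + 1) ≤ n + 1 → occursAt T (α ++ [c]) s →
        (∀ s', 1 ≤ s' → s' + (α.length + 1) ≤ n + 1 → occursAt T (α ++ [c]) s' → s' ≠ s →
          List.Lex (· < ·) (sufList T n s') (sufList T n s)) →
        s + α.length ∈ PDA T n (fun i => n - ISA i + 1)) := by
  constructor
  · rintro c - ⟨c', hlt, j, hj, hjn, hjo⟩ s hs hsn hso hmin
    simp only [List.length_append, List.length_singleton] at hjn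
    have hso' := (my_occ _ _ _ _).mp hso
    have hjo' := (my_occ _ _ _ _).mp hjo
    refine my_main T n ISA α c c' hlt.ne s j hs hsn hso hj hjn hjo
      (my_isa_range T n SA ISA hSA hISA j hj (by omega)).1 ?_ ?_
    · apply my_isa_lt T n SA ISA hSA hISA j s hj (by omega) hs (by omega)
      apply my_lex_of_mismatch T n α.length j s (by omega) (by omega)
      · exact fun t ht => (hjo'.1 t ht).trans (hso'.1 t ht).symm
      · rw [hjo'.2, hso'.2]
        exact hlt
    · intro s' h1 h2 h3 h4
      exact my_isa_lt T n SA ISA hSA hISA s s' hs (by omega) h1 (by omega) (hmin s' h1 h2 h3 h4)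
  · rintro c - ⟨c', hlt, j, hj, hjn, hjo⟩ s hs hsn hso hmin
    simp only [List.length_append, List.length_singleton] at hjn
    have hso' := (my_occ _ _ _ _).mp hso
    have hjo' := (my_occ _ _ _ _).mp hjo
    have rj := my_isa_range T n SA ISA hSA hISA j hj (by omega)
    refine my_main T n (fun i => n - ISA i + 1) α c c' hlt.ne' s j hs hsn hso hj hjn hjo
      (by simp) ?_ ?_
    · have : ISA s < ISA j := by
        apply my_isa_lt T n SA ISA hSA hISA s j hs (by omega) hj (by omega)
        apply my_lex_of_mismatch T n α.length s j (by omega) (by omega)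
        · exact fun t ht => (hso'.1 t ht).trans (hjo'.1 t ht).symm
        · rw [hjo'.2, hso'.2]
          exact hlt
      show n - ISA j + 1 < n - ISA s + 1
      omega
    · intro s' h1 h2 h3 h4
      have := my_isa_lt T n SA ISA hSA hISA s' s h1 (by omega) hs (by omega) (hmin s' h1 h2 h3 h4)
      have rs := my_isa_range T n SA ISA hSA hISA s hs (by omega)
      show n - ISA s + 1 < n - ISA s' + 1
      omega
end

section
/- Let T be a text of length n over a finite totally ordered alphabet Σ. Then the permutation π defined by π(i) = IPA(i) and the permutation π̄ defined by π̄(i) = n − IPA(i) + 1 are both order-preserving for T; moreover, |st-colex^-| ≤ r̄ and |st-colex^+| ≤ r̄, i.e., each of the sets {i + LPF_{IPA}[i] : i ∈ [n]} and {i + LPF_{π̄}[i] : i ∈ [n]} has cardinality at most r̄, the number of maximal equal-symbol runs of the co-Burrows–Wheeler transform of T. -/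
/-!
Common definitions: strings are modeled as functions `S : ℕ → A` with 1-based
positions `1,…,n`; patterns/substrings as `List A`.
-/

open scoped Classical

section Aux

variable {A : Type*}

theorem aux_rlce_spec (S : ℕ → A) (n i j : ℕ) (hi : i ≤ n + 1) (hj : j ≤ n + 1) :
    i + rlce S n i j ≤ n + 1 ∧ j + rlce S n i j ≤ n + 1 ∧
      ∀ t < rlce S n i j, S (i + t) = S (j + t) := by
  have h := Nat.findGreatest_spec (m := 0) (n := n)
    (P := fun k => i + k ≤ n + 1 ∧ j + k ≤ n + 1 ∧ ∀ t < k, S (i + t) = S (j + t))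
    (Nat.zero_le _) ⟨by omega, by omega, by intro t ht; omega⟩
  exact h

theorem aux_le_rlce (S : ℕ → A) (n i j k : ℕ) (hi1 : 1 ≤ i) (hi : i + k ≤ n + 1)
    (hj : j + k ≤ n + 1) (h : ∀ t < k, S (i + t) = S (j + t)) : k ≤ rlce S n i j := by
  unfold rlce
  exact Nat.le_findGreatest (by omega) ⟨hi, hj, h⟩

theorem aux_le_LPF (S : ℕ → A) (n : ℕ) (π : ℕ → ℕ) (i j : ℕ) (hj1 : 1 ≤ j) (hjn : j ≤ n)
    (hp : 1 ≤ π j) (h : π j < π i) : rlce S n j i ≤ LPF S n π i := by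
  unfold LPF
  rw [if_neg (by omega)]
  exact Finset.le_sup (f := fun j => rlce S n j i)
    (by simp only [Finset.mem_filter, Finset.mem_Icc]; exact ⟨⟨hj1, hjn⟩, h⟩)

theorem aux_LPF_cases (S : ℕ → A) (n : ℕ) (π : ℕ → ℕ) (i : ℕ) :
    LPF S n π i = 0 ∨ ∃ j, 1 ≤ j ∧ j ≤ n ∧ π j < π i ∧ LPF S n π i = rlce S n j i := by
  by_cases h : π i = 1
  · left; unfold LPF; rw [if_pos h]
  · by_cases hne : ((Finset.Icc 1 n).filter (fun j => π j < π i)).Nonempty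
    · right
      obtain ⟨j, hj, he⟩ := Finset.exists_mem_eq_sup _ hne (fun j => rlce S n j i)
      simp only [Finset.mem_filter, Finset.mem_Icc] at hj
      refine ⟨j, hj.1.1, hj.1.2, hj.2, ?_⟩
      unfold LPF
      rw [if_neg h, he]
    · left
      unfold LPF
      rw [if_neg h, Finset.not_nonempty_iff_eq_empty.1 hne]
      simp

/-- order is carried forward along matches -/
theorem aux_fwd (T : ℕ → A) (n : ℕ) (π : ℕ → ℕ)
    (hb : ∀ i j, 1 ≤ i → i < n → 1 ≤ j → j < n → T (i + 1) = T (j + 1) → π i < π j →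
      π (i + 1) < π (j + 1)) (i j : ℕ) (hi : 1 ≤ i) (hj : 1 ≤ j) (h : π i < π j) (l : ℕ) :
    i + l ≤ n → j + l ≤ n → (∀ t ≤ l, T (i + t) = T (j + t)) → π (i + l) < π (j + l) := by
  induction l with
  | zero => intro _ _ _; exact h
  | succ l ih =>
    intro h1 h2 h3
    exact hb (i + l) (j + l) (by omega) (by omega) (by omega) (by omega)
      (h3 (l + 1) le_rfl) (ih (by omega) (by omega) (fun t ht => h3 t (by omega)))

theorem aux_core (T : ℕ → A) (n : ℕ) (π : ℕ → ℕ)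
    (htext : ∀ i, 1 ≤ i → i < n → T i ≠ T n)
    (hpos : ∀ i, 1 ≤ i → i ≤ n → 1 ≤ π i)
    (hinj : ∀ i j, 1 ≤ i → i ≤ n → 1 ≤ j → j ≤ n → π i = π j → i = j)
    (hb : ∀ i j, 1 ≤ i → i < n → 1 ≤ j → j < n → T (i + 1) = T (j + 1) → π i < π j →
      π (i + 1) < π (j + 1))
    (hs : ∀ l x q y, 1 ≤ x → x ≤ n → 1 ≤ q → q ≤ n → 1 ≤ y → y ≤ n → l ≤ x → l ≤ y →
      π x ≤ π q → π q ≤ π y → (∀ t < l, T (x - t) = T (y - t)) →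
      l ≤ q ∧ ∀ t < l, T (q - t) = T (y - t))
    (i : ℕ) (hi1 : 1 ≤ i) (hin : i ≤ n) :
    i + LPF T n π i ≤ n ∧ (2 ≤ i + LPF T n π i → ∀ q, 1 ≤ q → q ≤ n →
      π q + 1 = π (i + LPF T n π i - 1) →
      (q ≠ n → T (q + 1) ≠ T (i + LPF T n π i)) ∧ (q = n → LPF T n π i = 0)) := by
  have hmax : ∀ j, 1 ≤ j → j + LPF T n π i ≤ n → i + LPF T n π i ≤ n → π j < π i →
      (∀ t ≤ LPF T n π i, T (j + t) = T (i + t)) → False := by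
    intro j hj1 hjn hin' hlt hm
    have h1 := aux_le_LPF T n π i j hj1 (by omega) (hpos j hj1 (by omega)) hlt
    have h2 := aux_le_rlce T n j i (LPF T n π i + 1) hj1 (by omega) (by omega)
      (fun t ht => hm t (by omega))
    omega
  rcases aux_LPF_cases T n π i with h0 | ⟨j, hj1, hjn, hlt, he⟩
  · rw [h0] at hmax ⊢
    refine ⟨hin, fun h2 q hq1 hqn hq => ⟨fun hne hT => ?_, fun _ => rfl⟩⟩
    refine hmax (q + 1) (by omega) (by omega) (by omega) ?_ ?_
    · have := hb q (i - 1) hq1 (by omega) (by omega) (by omega)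
        (by rw [Nat.sub_add_cancel hi1]; exact hT) (by simp only [Nat.add_zero] at hq; omega)
      rwa [Nat.sub_add_cancel hi1] at this
    · intro t ht
      obtain rfl : t = 0 := by omega
      exact hT
  · obtain ⟨hr1, hr2, hr3⟩ := aux_rlce_spec T n j i (by omega) (by omega)
    rw [← he] at hr1 hr2 hr3
    generalize LPF T n π i = l at *
    have hij : j ≠ i := by rintro rfl; omega
    by_cases hl : l = 0
    · subst hl
      refine ⟨hin, fun h2 q hq1 hqn hq => ⟨fun hne hT => ?_, fun _ => rfl⟩⟩
      refine hmax (q + 1) (by omega) (by omega) (by omega) ?_ ?_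
      · have := hb q (i - 1) hq1 (by omega) (by omega) (by omega)
          (by rw [Nat.sub_add_cancel hi1]; exact hT) (by simp only [Nat.add_zero] at hq; omega)
        rwa [Nat.sub_add_cancel hi1] at this
      · intro t ht
        obtain rfl : t = 0 := by omega
        exact hT
    have hlast := hr3 (l - 1) (by omega)
    have hen : i + l ≤ n := by
      by_contra hc
      have e1 : i + (l - 1) = n := by omega
      rw [e1] at hlast
      exact htext (j + (l - 1)) (by omega) (by omega) hlast
    refine ⟨hen, fun h2 q hq1 hqn hq => ?_⟩
    have hf : π (j + (l - 1)) < π (i + (l - 1)) :=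
      aux_fwd T n π hb j i hj1 hi1 hlt (l - 1) (by omega) (by omega)
        (fun t ht => hr3 t (by omega))
    have ei : i + l - 1 = i + (l - 1) := by omega
    rw [ei] at hq
    obtain ⟨hlq, hqm⟩ := hs l (j + (l - 1)) q (i + (l - 1)) (by omega) (by omega) hq1 hqn
      (by omega) (by omega) (by omega) (by omega) (by omega) (by omega) (by
        intro t ht
        have := hr3 (l - 1 - t) (by omega)
        rwa [show j + (l - 1) - t = j + (l - 1 - t) by omega,
          show i + (l - 1) - t = i + (l - 1 - t) by omega])
    constructor
    · intro hne hT
      obtain ⟨k, hk⟩ : ∃ k, q = k + (l - 1) := ⟨q - (l - 1), by omega⟩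
      have hm : ∀ t ≤ l, T (k + t) = T (i + t) := by
        intro t ht
        rcases Nat.lt_or_ge t l with h | h
        · have := hqm (l - 1 - t) (by omega)
          rwa [show q - (l - 1 - t) = k + t by omega,
            show i + (l - 1) - (l - 1 - t) = i + t by omega] at this
        · obtain rfl : t = l := by omega
          rwa [show k + t = q + 1 by omega]
      rcases lt_trichotomy (π k) (π i) with h | h | h
      · exact hmax k (by omega) (by omega) hen h hm
      · have := hinj k i (by omega) (by omega) hi1 hin h
        subst this
        rw [← hk] at hq
        omega
      · have := aux_fwd T n π hb i k hi1 (by omega) h (l - 1) (by omega) (by omega)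
          (fun t ht => (hm t (by omega)).symm)
        rw [← hk] at this
        omega
    · intro hqn'
      have := hqm 0 (by omega)
      simp only [Nat.sub_zero] at this
      rw [hqn'] at this
      exact absurd this.symm (htext _ (by omega) (by omega))

theorem aux_sandwich [LinearOrder A] (T : ℕ → A) (n : ℕ) (r : ℕ → ℕ)
    (hinj : ∀ i j, 1 ≤ i → i ≤ n → 1 ≤ j → j ≤ n → r i = r j → i = j)
    (ha : ∀ i j, 1 ≤ i → i ≤ n → 1 ≤ j → j ≤ n → T i < T j → r i < r j)
    (hb : ∀ i j, 1 ≤ i → i < n → 1 ≤ j → j < n → T (i + 1) = T (j + 1) → r i < r j →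
      r (i + 1) < r (j + 1))
    (hc : ∀ j, 2 ≤ j → j ≤ n → T 1 = T j → r 1 < r j) (l : ℕ) :
    ∀ x q y, 1 ≤ x → x ≤ n → 1 ≤ q → q ≤ n → 1 ≤ y → y ≤ n → l ≤ x → l ≤ y →
      r x ≤ r q → r q ≤ r y → (∀ t < l, T (x - t) = T (y - t)) →
      l ≤ q ∧ ∀ t < l, T (q - t) = T (y - t) := by
  have hb' : ∀ i j, 1 ≤ i → i < n → 1 ≤ j → j < n → T (i + 1) = T (j + 1) →
      r (i + 1) ≤ r (j + 1) → r i ≤ r j := by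
    intro i j h1 h2 h3 h4 h5 h6
    by_contra hlt
    have := hb j i h3 h4 h1 h2 h5.symm (by omega)
    omega
  induction l with
  | zero => intros; exact ⟨by omega, by intro t ht; omega⟩
  | succ l ih =>
    intro x q y hx1 hxn hq1 hqn hy1 hyn hlx hly hxq hqy hm
    have hxy : T x = T y := hm 0 (by omega)
    have hq : T q = T y := by
      apply le_antisymm
      · by_contra hlt
        have := ha y q hy1 hyn hq1 hqn (not_le.1 hlt)
        omega
      · rw [← hxy]
        by_contra hlt
        have := ha q x hq1 hqn hx1 hxn (not_le.1 hlt)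
        omega
    by_cases hl : l = 0
    · subst hl
      refine ⟨by omega, fun t ht => ?_⟩
      obtain rfl : t = 0 := by omega
      exact hq
    have hq2 : q ≠ 1 := by
      rintro rfl
      have := hc x (by omega) hxn (hq.trans hxy.symm)
      omega
    obtain ⟨x, rfl⟩ : ∃ k, x = k + 1 := ⟨x - 1, by omega⟩
    obtain ⟨y, rfl⟩ : ∃ k, y = k + 1 := ⟨y - 1, by omega⟩
    obtain ⟨q, rfl⟩ : ∃ k, q = k + 1 := ⟨q - 1, by omega⟩
    obtain ⟨g1, g2⟩ := ih x q y (by omega) (by omega) (by omega) (by omega) (by omega) (by omega)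
      (by omega) (by omega)
      (hb' x q (by omega) (by omega) (by omega) (by omega) (hxy.trans hq.symm) hxq)
      (hb' q y (by omega) (by omega) (by omega) (by omega) hq hqy) (by
        intro t ht
        have := hm (t + 1) (by omega)
        rwa [Nat.add_sub_add_right, Nat.add_sub_add_right] at this)
    refine ⟨by omega, fun t ht => ?_⟩
    cases t with
    | zero => exact hq
    | succ t =>
      rw [Nat.add_sub_add_right, Nat.add_sub_add_right]
      exact g2 t (by omega)

theorem aux_preList_succ (T : ℕ → A) (i : ℕ) :
    (preList T (i + 1)).reverse = T (i + 1) :: (preList T i).reverse := by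
  unfold preList
  rw [List.range_succ, List.map_append, List.reverse_append]
  simp [Nat.add_comm]

theorem aux_runs_start (B : ℕ → A) (n : ℕ) (P : ℕ → Prop)
    (hP : ∀ k, P k → k = 1 ∨ B k ≠ B (k - 1)) :
    ((Finset.Icc 1 n).filter P).card ≤ runs B n := by
  unfold runs
  rw [Nat.add_comm]
  refine (Finset.card_le_card ?_).trans
    (Finset.card_insert_le 1 ((Finset.Icc 2 n).filter (fun i => B i ≠ B (i - 1))))
  intro k hk
  simp only [Finset.mem_filter, Finset.mem_Icc, Finset.mem_insert] at hk ⊢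
  rcases hk with ⟨⟨h1, h2⟩, h3⟩
  replace h3 := hP k h3
  by_cases h : k = 1
  · exact Or.inl h
  · exact Or.inr ⟨⟨by omega, h2⟩, h3.resolve_left h⟩

theorem aux_runs_end (B : ℕ → A) (n : ℕ) (P : ℕ → Prop)
    (hP : ∀ k, P k → k = n ∨ B (k + 1) ≠ B k) :
    ((Finset.Icc 1 n).filter P).card ≤ runs B n := by
  unfold runs
  rw [Nat.add_comm]
  refine (Finset.card_le_card (t := insert n
    (((Finset.Icc 2 n).filter (fun i => B i ≠ B (i - 1))).image (fun i => i - 1))) ?_).trans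
    ((Finset.card_insert_le _ _).trans (Nat.add_le_add_right Finset.card_image_le 1))
  intro k hk
  simp only [Finset.mem_filter, Finset.mem_Icc, Finset.mem_insert, Finset.mem_image] at hk ⊢
  rcases hk with ⟨⟨h1, h2⟩, h3⟩
  replace h3 := hP k h3
  by_cases h : k = n
  · exact Or.inl h
  · exact Or.inr ⟨k + 1, ⟨⟨by omega, by omega⟩, h3.resolve_left h⟩, rfl⟩

/-- the cyclic predecessor of a position -/
def auxPred (n e : ℕ) : ℕ := if e = 1 then n else e - 1

theorem aux_count (T : ℕ → A) (n : ℕ) (π IPA : ℕ → ℕ) (P : ℕ → Prop)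
    (hrange : ∀ i, 1 ≤ i → i ≤ n → 1 ≤ IPA i ∧ IPA i ≤ n)
    (hinj : ∀ i j, 1 ≤ i → i ≤ n → 1 ≤ j → j ≤ n → IPA i = IPA j → i = j)
    (hP : ∀ i, 1 ≤ i → i ≤ n → i + LPF T n π i ≤ n ∧ P (IPA (auxPred n (i + LPF T n π i)))) :
    (PDA T n π).card ≤ ((Finset.Icc 1 n).filter P).card := by
  have hmem : ∀ e ∈ PDA T n π, 1 ≤ e ∧ e ≤ n ∧ P (IPA (auxPred n e)) := by
    intro e he
    unfold PDA at he
    simp only [Finset.mem_image, Finset.mem_Icc] at he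
    obtain ⟨i, ⟨h1, h2⟩, rfl⟩ := he
    exact ⟨by omega, hP i h1 h2⟩
  have hpr : ∀ e, 1 ≤ e → e ≤ n → 1 ≤ auxPred n e ∧ auxPred n e ≤ n := by
    intro e h1 h2
    unfold auxPred
    split_ifs <;> omega
  refine Finset.card_le_card_of_injOn (fun e => IPA (auxPred n e)) ?_ ?_
  · intro e he
    obtain ⟨h1, h2, h3⟩ := hmem e he
    have h4 := hpr e h1 h2
    have h5 := hrange _ h4.1 h4.2
    simp only [Finset.coe_filter, Set.mem_ofPred_eq, Finset.mem_Icc]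
    exact ⟨h5, h3⟩
  · intro e he f hf hef
    obtain ⟨h1, h2, -⟩ := hmem e he
    obtain ⟨h3, h4, -⟩ := hmem f hf
    have h5 := hpr e h1 h2
    have h6 := hpr f h3 h4
    have := hinj _ _ h5.1 h5.2 h6.1 h6.2 hef
    unfold auxPred at this
    split_ifs at this <;> omega

end Aux

/-- For a text `T[1,n]`, the inverse prefix array `IPA` and its dual
`i ↦ n - IPA i + 1` are order-preserving, and the corresponding sets `st-colex⁻` and
`st-colex⁺` each have cardinality at most `r̄`, the number of runs of the
co-Burrows–Wheeler transform. -/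
theorem IPA_orderPreserving_and_stcolex_le_runs {A : Type*} [Fintype A] [LinearOrder A]
    (T : ℕ → A) (n : ℕ) (htext : IsText T n)
    (PA IPA : ℕ → ℕ) (hPA : IsPA T n PA) (hIPA : IsInv PA IPA n) :
    OrderPres T n IPA ∧ OrderPres T n (fun i => n - IPA i + 1) ∧
    (PDA T n IPA).card ≤ runs (coBWT T n PA) n ∧
    (PDA T n (fun i => n - IPA i + 1)).card ≤ runs (coBWT T n PA) n := by
  obtain ⟨hn, htx⟩ := htext
  obtain ⟨hperm, hlex⟩ := hPA
  obtain ⟨hI1, hI2⟩ := hIPA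
  have hr : ∀ i, 1 ≤ i → i ≤ n → 1 ≤ IPA i ∧ IPA i ≤ n := by
    intro i h1 h2
    obtain ⟨k, hk, rfl⟩ := hperm.surjOn (Set.mem_Icc.2 ⟨h1, h2⟩)
    rw [hI1 k hk.1 hk.2]
    exact hk
  have hPr : ∀ i, 1 ≤ i → i ≤ n → 1 ≤ PA i ∧ PA i ≤ n :=
    fun i h1 h2 => hperm.mapsTo (Set.mem_Icc.2 ⟨h1, h2⟩)
  have hinj : ∀ i j, 1 ≤ i → i ≤ n → 1 ≤ j → j ≤ n → IPA i = IPA j → i = j := by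
    intro i j h1 h2 h3 h4 h
    rw [← hI2 i h1 h2, ← hI2 j h3 h4, h]
  have hlt : ∀ i j, 1 ≤ i → i ≤ n → 1 ≤ j → j ≤ n → IPA i < IPA j →
      List.Lex (· < ·) (preList T i).reverse (preList T j).reverse := by
    intro i j h1 h2 h3 h4 h
    have := hlex (IPA i) (IPA j) (hr i h1 h2).1 h (hr j h3 h4).2
    rwa [hI2 i h1 h2, hI2 j h3 h4] at this
  have ha : ∀ i j, 1 ≤ i → i ≤ n → 1 ≤ j → j ≤ n → T i < T j → IPA i < IPA j := by
    intro i j h1 h2 h3 h4 h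
    by_contra hc
    rcases Nat.lt_or_ge (IPA j) (IPA i) with h' | h'
    · have := hlt j i h3 h4 h1 h2 h'
      obtain ⟨i, rfl⟩ : ∃ k, i = k + 1 := ⟨i - 1, by omega⟩
      obtain ⟨j, rfl⟩ : ∃ k, j = k + 1 := ⟨j - 1, by omega⟩
      rw [aux_preList_succ, aux_preList_succ] at this
      generalize T (i + 1) = a at h this
      generalize T (j + 1) = b at h this
      cases this with
      | cons h'' => exact lt_irrefl _ h
      | rel h'' => exact lt_asymm h h''
    · have := hinj i j h1 h2 h3 h4 (by omega)
      subst this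
      exact lt_irrefl _ h
  have hb : ∀ i j, 1 ≤ i → i < n → 1 ≤ j → j < n → T (i + 1) = T (j + 1) → IPA i < IPA j →
      IPA (i + 1) < IPA (j + 1) := by
    intro i j h1 h2 h3 h4 he h
    by_contra hc
    have hne : IPA (i + 1) ≠ IPA (j + 1) := by
      intro h'
      have := hinj (i + 1) (j + 1) (by omega) (by omega) (by omega) (by omega) h'
      obtain rfl : i = j := by omega
      omega
    have h5 := hlt (j + 1) (i + 1) (by omega) (by omega) (by omega) (by omega) (by omega)
    have h6 := hlt i j h1 (by omega) h3 (by omega) h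
    rw [aux_preList_succ, aux_preList_succ, he] at h5
    have h7 : List.Lex (· < ·) (preList T j).reverse (preList T i).reverse := by
      cases h5 with
      | cons h'' => exact h''
      | rel h'' => exact absurd h'' (lt_irrefl _)
    exact absurd h7 (asymm h6)
  have hc : ∀ j, 2 ≤ j → j ≤ n → T 1 = T j → IPA 1 < IPA j := by
    intro j h1 h2 he
    by_contra hc
    have hne : IPA 1 ≠ IPA j := by
      intro h'
      have := hinj 1 j (by omega) (by omega) (by omega) (by omega) h'
      omega
    have h5 := hlt j 1 (by omega) (by omega) (by omega) (by omega) (by omega)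
    obtain ⟨j, rfl⟩ : ∃ k, j = k + 1 + 1 := ⟨j - 2, by omega⟩
    have e1 := aux_preList_succ T 0
    simp only [Nat.zero_add] at e1
    rw [aux_preList_succ, aux_preList_succ, e1, he] at h5
    have e0 : (preList T 0).reverse = [] := by simp [preList]
    rw [e0] at h5
    cases h5 with
    | cons h'' => cases h''
    | rel h'' => exact absurd h'' (lt_irrefl _)
  have hn1 : IPA n = 1 := by
    by_contra hne
    have h1 := hr n hn le_rfl
    have h2 := hPr 1 le_rfl hn
    have h3 : IPA (PA 1) = 1 := hI1 1 le_rfl hn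
    have h4 : PA 1 ≠ n := by
      intro h; rw [h] at h3; exact hne h3
    have := ha n (PA 1) hn le_rfl h2.1 h2.2 (htx _ h2.1 (by omega))
    omega
  have htne : ∀ i, 1 ≤ i → i < n → T i ≠ T n := fun i h1 h2 => (htx i h1 h2).ne'
  have hs := aux_sandwich T n IPA hinj ha hb hc
  have hB : ∀ k, 1 ≤ k → k ≤ n → ∃ q, 1 ≤ q ∧ q ≤ n ∧ IPA q = k ∧
      coBWT T n PA k = T (if q = n then 1 else q + 1) :=
    fun k h1 h2 => ⟨PA k, (hPr k h1 h2).1, (hPr k h1 h2).2, hI1 k h1 h2, rfl⟩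
  have hBI : ∀ p, 1 ≤ p → p ≤ n → coBWT T n PA (IPA p) = T (if p = n then 1 else p + 1) := by
    intro p h1 h2
    unfold coBWT
    rw [hI2 p h1 h2]
  -- dual
  have hinj' : ∀ i j, 1 ≤ i → i ≤ n → 1 ≤ j → j ≤ n →
      (fun i => n - IPA i + 1) i = (fun i => n - IPA i + 1) j → i = j := by
    intro i j h1 h2 h3 h4 h
    have := hr i h1 h2
    have := hr j h3 h4
    simp only at h
    exact hinj i j h1 h2 h3 h4 (by omega)
  have hb' : ∀ i j, 1 ≤ i → i < n → 1 ≤ j → j < n → T (i + 1) = T (j + 1) →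
      (fun i => n - IPA i + 1) i < (fun i => n - IPA i + 1) j →
      (fun i => n - IPA i + 1) (i + 1) < (fun i => n - IPA i + 1) (j + 1) := by
    intro i j h1 h2 h3 h4 he h
    have := hr i h1 h2.le
    have := hr j h3 h4.le
    have := hr (i + 1) (by omega) h2
    have := hr (j + 1) (by omega) h4
    simp only at h ⊢
    have := hb j i h3 h4 h1 h2 he.symm (by omega)
    omega
  refine ⟨?_, ?_, ?_, ?_⟩
  · intro i j h1 h2 h3 h4 h _ he
    exact hb i j h1 h2 h3 h4 he h
  · intro i j h1 h2 h3 h4 h _ he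
    exact hb' i j h1 h2 h3 h4 he h
  · refine (aux_count T n IPA IPA
      (fun k => k = 1 ∨ coBWT T n PA k ≠ coBWT T n PA (k - 1)) hr hinj ?_).trans
      (aux_runs_start (coBWT T n PA) n _ (fun k hk => hk))
    intro i h1 h2
    obtain ⟨he, hcore⟩ := aux_core T n IPA htne (fun i h1 h2 => (hr i h1 h2).1) hinj hb hs i h1 h2
    refine ⟨he, ?_⟩
    by_cases h : i + LPF T n IPA i = 1
    · left; unfold auxPred; rw [if_pos h, hn1]
    · right
      unfold auxPred
      rw [if_neg h]
      have hp := hr (i + LPF T n IPA i - 1) (by omega) (by omega)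
      have hp2 : IPA (i + LPF T n IPA i - 1) ≠ 1 := by
        rw [← hn1]
        intro h'
        have := hinj _ _ (by omega) (by omega) hn le_rfl h'
        omega
      obtain ⟨q, hq1, hqn, hq, hqB⟩ := hB (IPA (i + LPF T n IPA i - 1) - 1) (by omega) (by omega)
      obtain ⟨c1, c2⟩ := hcore (by omega) q hq1 hqn (by omega)
      rw [hqB, hBI _ (by omega) (by omega), if_neg (show ¬ i + LPF T n IPA i - 1 = n by omega),
        Nat.sub_add_cancel (by omega)]
      intro hT
      by_cases hqe : q = n
      · have h0 := c2 hqe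
        rw [if_pos hqe, h0] at hT
        have h3 := hc i (by omega) h2 hT.symm
        have h4 := aux_le_LPF T n IPA i 1 le_rfl hn (hr 1 le_rfl hn).1 h3
        have h5 := aux_le_rlce T n 1 i 1 le_rfl (by omega) (by omega) (by
          intro t ht
          obtain rfl : t = 0 := by omega
          exact hT.symm)
        omega
      · rw [if_neg hqe] at hT
        exact c1 hqe hT.symm
  · refine (aux_count T n (fun i => n - IPA i + 1) IPA
      (fun k => k = n ∨ coBWT T n PA (k + 1) ≠ coBWT T n PA k) hr hinj ?_).trans
      (aux_runs_end (coBWT T n PA) n _ (fun k hk => hk))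
    intro i h1 h2
    obtain ⟨he, hcore⟩ := aux_core T n (fun i => n - IPA i + 1) htne (fun i h1 h2 => by simp)
      hinj' hb' (by
        intro l x q y hx1 hxn hq1 hqn hy1 hyn hlx hly hxq hqy hm
        have := hr x hx1 hxn
        have := hr q hq1 hqn
        have := hr y hy1 hyn
        obtain ⟨g1, g2⟩ := hs l y q x hy1 hyn hq1 hqn hx1 hxn hly hlx (by omega) (by omega)
          (fun t ht => (hm t ht).symm)
        exact ⟨g1, fun t ht => (g2 t ht).trans (hm t ht)⟩) i h1 h2
    refine ⟨he, ?_⟩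
    by_cases h : i + LPF T n (fun i => n - IPA i + 1) i = 1
    · unfold auxPred
      rw [if_pos h]
      by_cases hnn : n = 1
      · left; rw [hn1, hnn]
      right
      have hi : i = 1 := by omega
      have h0 : LPF T n (fun i => n - IPA i + 1) i = 0 := by omega
      obtain ⟨q, hq1, hqn, hq, hqB⟩ := hB (IPA n + 1) (by omega) (by omega)
      rw [hqB, hBI n hn le_rfl, if_pos rfl]
      have hqe : q ≠ n := by rintro rfl; omega
      rw [if_neg hqe]
      intro hT
      have h3 := hc (q + 1) (by omega) (by omega) hT.symm
      have := hr (q + 1) (by omega) (by omega)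
      have h4 := aux_le_LPF T n (fun i => n - IPA i + 1) i (q + 1) (by omega) (by omega)
        (by simp) (by simp only [hi]; omega)
      have h5 := aux_le_rlce T n (q + 1) i 1 (by omega) (by omega) (by omega) (by
          intro t ht
          obtain rfl : t = 0 := by omega
          rw [hi]
          exact hT)
      omega
    · generalize LPF T n (fun i => n - IPA i + 1) i = l at *
      unfold auxPred
      rw [if_neg h]
      by_cases hpn : IPA (i + l - 1) = n
      · left; exact hpn
      right
      have hp := hr (i + l - 1) (by omega) (by omega)
      obtain ⟨q, hq1, hqn, hq, hqB⟩ := hB (IPA (i + l - 1) + 1) (by omega) (by omega)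
      obtain ⟨c1, c2⟩ := hcore (by omega) q hq1 hqn (by omega)
      have hqe : q ≠ n := by rintro rfl; omega
      rw [hqB, hBI _ (by omega) (by omega), if_neg hqe, if_neg (by omega),
        Nat.sub_add_cancel (by omega)]
      exact c1 hqe
end

section
/- Let T be a text of length n over a finite totally ordered alphabet Σ, let π be an order-preserving permutation for T, and let m ≥ 1. For every position j ∈ [n] with j + m − 1 ≤ n and LPF_π[j] ≥ m (i.e., for every secondary occurrence of a length-m pattern starting at j), there exists an irreducible LPF_π position i with LPF_π[i] > 0 such that i ≤ j and j + m − 1 ≤ i + LPF_π[i] − 1 (the occurrence is entirely contained in the type-2 phrase T[i, i + LPF_π[i] − 1]). -/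
/-!
Common definitions: strings are modeled as functions `S : ℕ → A` with 1-based
positions `1,…,n`; patterns/substrings as `List A`.
-/

open scoped Classical

/-- Every secondary occurrence (a position `j` with `LPF_π[j] ≥ m`)
of a length-`m` pattern is entirely contained in a type-2 phrase
`T[i, i + LPF_π[i] - 1]` starting at an irreducible position `i` with `LPF_π[i] > 0`. -/
theorem secondary_contained_in_type2_phrase {A : Type*} [Fintype A] [LinearOrder A]
    (T : ℕ → A) (n : ℕ) (htext : IsText T n)
    (π : ℕ → ℕ) (hperm : PermOn π n) (hop : OrderPres T n π)
    (m : ℕ) (hm : 1 ≤ m) :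
    ∀ j, 1 ≤ j → j ≤ n → j + m - 1 ≤ n → m ≤ LPF T n π j →
      ∃ i, 1 ≤ i ∧ i ≤ n ∧ Irr T n π i ∧ 0 < LPF T n π i ∧
        i ≤ j ∧ j + m - 1 ≤ i + LPF T n π i - 1 := by
  intro j
  induction j generalizing m with
  | zero => intro h; omega
  | succ k ih =>
    intro h1 h2 h3 h4
    by_cases hI : Irr T n π (k + 1)
    · exact ⟨k + 1, h1, h2, hI, by omega, le_refl _, by omega⟩
    · unfold Irr at hI
      rw [not_or, not_not, Nat.add_sub_cancel] at hI
      obtain ⟨ha, hb⟩ := hI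
      obtain ⟨i, a, b, c, d, e, f⟩ :=
        ih (m + 1) (by omega) (by omega) (by omega) (by omega) (by omega)
      exact ⟨i, a, b, c, d, by omega, by omega⟩
end
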